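/- Let n ≥ 3, x₀ ∈ ℝⁿ, R > 0, and let H be a harmonic function on the ball B(x₀,R). Define G(x) := c_n|x−x₀|^{2−n} − H(x) for x ∈ B(x₀,R)∖{x₀}. Then for every r ∈ (0,R) and every j ∈ {1,…,n}: ∫_{∂B(x₀,r)} [ 2 (∂G/∂ν)(∂G/∂x_j) − |∇G|² ν_j ] dS = 2(n−2) c_n ω_{n−1} (∂H/∂x_j)(x₀). In particular the left-hand side is independent of r ∈ (0,R). -/

import Mathlib

open MeasureTheory Metric Filter Topology RealInnerProductSpace

noncomputable section

abbrev Euc (n : ℕ) := EuclideanSpace ℝ (Fin n)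

noncomputable def surf (n : ℕ) : Measure (Euc n) := μH[(n : ℝ) - 1]

noncomputable def omegaSph (n : ℕ) : ℝ := (surf n (sphere (0 : Euc n) 1)).toReal

/-- `c_n = 1/((n-2) ω_{n-1})`. -/
noncomputable def cGreen (n : ℕ) : ℝ := 1 / (((n : ℝ) - 2) * omegaSph n)

/-- Laplacian on `ℝⁿ`. -/
noncomputable def lap (n : ℕ) (u : Euc n → ℝ) (x : Euc n) : ℝ :=
  ∑ i : Fin n, fderiv ℝ (fun y => fderiv ℝ u y (EuclideanSpace.single i 1)) x
    (EuclideanSpace.single i 1)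

theorem lipschitzOnWith_inv_norm_smul {E : Type*} [NormedAddCommGroup E] [NormedSpace ℝ E] :
    LipschitzOnWith 2 (fun x : E => ‖x‖⁻¹ • x) {x | 1 ≤ ‖x‖} := by
  refine LipschitzOnWith.of_dist_le_mul fun x hx y hy => ?_
  simp only [Set.mem_ofPred_eq] at hx hy
  have hx0 : 0 < ‖x‖ := by linarith
  have hy0 : 0 < ‖y‖ := by linarith
  rw [dist_eq_norm, dist_eq_norm]
  have h1 : ‖x‖⁻¹ • x - ‖y‖⁻¹ • y = ‖x‖⁻¹ • (x - y) + (‖x‖⁻¹ - ‖y‖⁻¹) • y := by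
    rw [smul_sub, sub_smul]; abel
  have h2 : ‖x‖⁻¹ ≤ 1 := inv_le_one_of_one_le₀ hx
  have h3 : ‖(‖x‖⁻¹ - ‖y‖⁻¹) • y‖ ≤ ‖x - y‖ := by
    have : (‖x‖⁻¹ - ‖y‖⁻¹) = ‖x‖⁻¹ * ‖y‖⁻¹ * (‖y‖ - ‖x‖) := by field_simp
    rw [norm_smul, this, norm_mul, norm_mul, norm_inv, norm_inv, norm_norm, norm_norm]
    have h4 : ‖(‖y‖ - ‖x‖ : ℝ)‖ ≤ ‖x - y‖ := by
      rw [Real.norm_eq_abs, abs_sub_comm]; exact abs_norm_sub_norm_le x y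
    calc ‖x‖⁻¹ * ‖y‖⁻¹ * ‖(‖y‖ - ‖x‖ : ℝ)‖ * ‖y‖
        = ‖x‖⁻¹ * ‖(‖y‖ - ‖x‖ : ℝ)‖ := by field_simp
      _ ≤ 1 * ‖x - y‖ := by gcongr
      _ = _ := one_mul _
  rw [h1]
  calc _ ≤ ‖‖x‖⁻¹ • (x - y)‖ + ‖(‖x‖⁻¹ - ‖y‖⁻¹) • y‖ := norm_add_le _ _
    _ ≤ 1 * ‖x - y‖ + ‖x - y‖ := by
        gcongr
        rw [norm_smul, norm_inv, norm_norm]; gcongr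
    _ = _ := by simp; ring

/-- The parametrisation of the hyperplane `{x | x i = s}` by the other coordinates. -/
def faceMap {m : ℕ} (i : Fin (m + 1)) (s : ℝ) (y : Fin m → ℝ) : Euc (m + 1) :=
  WithLp.toLp 2 (i.insertNth s y)

theorem faceMap_apply_self {m : ℕ} (i : Fin (m + 1)) (s : ℝ) (y : Fin m → ℝ) :
    faceMap i s y i = s := by
  simp [faceMap]

theorem surf_image_faceMap_lt_top {m : ℕ} (i : Fin (m + 1)) (s : ℝ) (hs : |s| = 1) :
    surf (m + 1) ((fun x : Euc (m + 1) => ‖x‖⁻¹ • x) '' (faceMap i s '' Set.Icc (-1) 1)) < ⊤ := by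
  have hm : ((m + 1 : ℕ) : ℝ) - 1 = m := by push_cast; ring
  have hface : ∃ K, LipschitzWith K (faceMap i s) := by
    refine ⟨_, (PiLp.lipschitzWith_toLp 2 (fun _ : Fin (m + 1) => ℝ)).comp
      (g := fun y : Fin m → ℝ => (i.insertNth s y : Fin (m + 1) → ℝ)) (Kg := 1) ?_⟩
    refine LipschitzWith.of_dist_le_mul fun x y => ?_
    rw [Fin.dist_insertNth_insertNth]
    simp
  obtain ⟨K, hK⟩ := hface
  have hsub : faceMap i s '' Set.Icc (-1) 1 ⊆ {x : Euc (m + 1) | 1 ≤ ‖x‖} := by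
    rintro _ ⟨y, -, rfl⟩
    have := PiLp.norm_apply_le (faceMap i s y) i
    rwa [faceMap_apply_self, Real.norm_eq_abs, hs] at this
  rw [surf, hm]
  refine ((lipschitzOnWith_inv_norm_smul.mono hsub).hausdorffMeasure_image_le
    m.cast_nonneg).trans_lt (ENNReal.mul_lt_top (by simp) ?_)
  refine (hK.hausdorffMeasure_image_le m.cast_nonneg _).trans_lt
    (ENNReal.mul_lt_top (by simp) ?_)
  have h := hausdorffMeasure_pi_real (ι := Fin m)
  rw [Fintype.card_fin] at h
  rw [h]
  exact isCompact_Icc.measure_lt_top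

theorem sphere_subset_iUnion_image_faceMap (m : ℕ) :
    sphere (0 : Euc (m + 1)) 1 ⊆ ⋃ i : Fin (m + 1), ⋃ s ∈ ({1, -1} : Finset ℝ),
      (fun x : Euc (m + 1) => ‖x‖⁻¹ • x) '' (faceMap i s '' Set.Icc (-1) 1) := by
  intro x hx
  rw [mem_sphere_zero_iff_norm] at hx
  obtain ⟨i, hi⟩ := Finite.exists_max fun i => |x i|
  have hxi : x i ≠ 0 := by
    intro h
    have : x = 0 := by
      ext k
      have := hi k
      rw [h, abs_zero] at this
      simpa using this
    simp [this] at hx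
  have hpos : 0 < |x i| := abs_pos.2 hxi
  have hface : faceMap i (x i / |x i|) (i.removeNth fun k => x k / |x i|) = |x i|⁻¹ • x := by
    have : (x i / |x i|) = (fun k => x k / |x i|) i := rfl
    rw [faceMap, this, Fin.insertNth_self_removeNth (α := fun _ => ℝ) i fun k => x k / |x i|]
    ext k
    simp [div_eq_inv_mul]
  simp only [Set.mem_iUnion]
  refine ⟨i, x i / |x i|, ?_, _, ⟨_, ?_, hface⟩, ?_⟩
  · rcases lt_or_gt_of_ne hxi with h | h
    · simp [abs_of_neg h, div_neg, div_self hxi]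
    · simp [abs_of_pos h, div_self hxi]
  · rw [Set.mem_Icc, Pi.le_def, Pi.le_def, ← forall_and]
    intro k
    simp only [Fin.removeNth, Pi.neg_apply, Pi.one_apply]
    rw [← abs_le, abs_div, abs_abs, div_le_one hpos]
    exact hi _
  · simp only [norm_smul, norm_inv, Real.norm_eq_abs, abs_abs, hx, mul_one, inv_inv, smul_smul]
    rw [mul_inv_cancel₀ hpos.ne', one_smul]

theorem surf_sphere_lt_top {n : ℕ} (hn : 1 ≤ n) : surf n (sphere 0 1) < ⊤ := by
  obtain ⟨m, rfl⟩ := Nat.exists_eq_add_of_le' hn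
  refine (measure_mono (sphere_subset_iUnion_image_faceMap m)).trans_lt ?_
  refine (measure_iUnion_le _).trans_lt ?_
  rw [tsum_fintype]
  refine ENNReal.sum_lt_top.2 fun i _ => (measure_biUnion_finset_le _ _).trans_lt ?_
  refine ENNReal.sum_lt_top.2 fun s hs => surf_image_faceMap_lt_top i s ?_
  simp only [Finset.mem_insert, Finset.mem_singleton] at hs
  rcases hs with rfl | rfl <;> simp

theorem setIntegral_sphere_comp_linearIsometryEquiv {n : ℕ} (g : Euc n ≃ₗᵢ[ℝ] Euc n)
    (f : Euc n → ℝ) :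
    ∫ x in sphere (0 : Euc n) 1, f (g x) ∂(surf n) = ∫ x in sphere 0 1, f x ∂(surf n) := by
  have h := (g.toIsometryEquiv.measurePreserving_hausdorffMeasure
    ((n : ℝ) - 1)).setIntegral_preimage_emb
      g.toIsometryEquiv.toHomeomorph.toMeasurableEquiv.measurableEmbedding f (sphere 0 1)
  have hpre : g.toIsometryEquiv ⁻¹' sphere (0 : Euc n) 1 = sphere 0 1 := by
    ext x; simp
  rw [hpre] at h
  exact h

open scoped Pointwise in
theorem setIntegral_sphere_eq_smul {n : ℕ} (hn : 1 ≤ n) (x₀ : Euc n) {r : ℝ} (hr : 0 < r)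
    (f : Euc n → ℝ) :
    ∫ x in sphere x₀ r, f x ∂(surf n)
      = r ^ (n - 1) * ∫ x in sphere (0 : Euc n) 1, f (x₀ + r • x) ∂(surf n) := by
  have hn' : ((n - 1 : ℕ) : ℝ) = (n : ℝ) - 1 := by push_cast [hn]; ring
  have hd : 0 ≤ (n : ℝ) - 1 := by rw [← hn']; positivity
  let e : Euc n ≃ₜ Euc n := (Homeomorph.smulOfNeZero r hr.ne').trans (Homeomorph.addLeft x₀)
  have he : ∀ x, e x = x₀ + r • x := fun x => rfl
  have hmap : Measure.map e (surf n) = (r⁻¹.toNNReal ^ (n - 1)) • surf n := by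
    ext s hs
    have hpre : e ⁻¹' s = r⁻¹ • (IsometryEquiv.addLeft x₀ ⁻¹' s) := by
      ext x
      rw [Set.mem_smul_set_iff_inv_smul_mem₀ (inv_ne_zero hr.ne')]
      simp [he]
    have hnorm : ‖r⁻¹‖₊ = r⁻¹.toNNReal := (Real.toNNReal_eq_nnnorm_of_nonneg (inv_pos.2 hr).le).symm
    rw [Measure.map_apply e.continuous.measurable hs, hpre, surf,
      Measure.hausdorffMeasure_smul₀ hd (inv_ne_zero hr.ne'),
      IsometryEquiv.hausdorffMeasure_preimage, hnorm, ← hn', NNReal.rpow_natCast]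
    rfl
  have hpre : e ⁻¹' sphere x₀ r = sphere 0 1 := by
    ext x
    simp [he, norm_smul, abs_of_pos hr, hr.ne']
  have h := setIntegral_map_equiv e.toMeasurableEquiv f (sphere x₀ r) (μ := surf n)
  simp only [Homeomorph.toMeasurableEquiv_coe, hmap, hpre, he] at h
  rw [← h, Measure.restrict_smul, integral_smul_nnreal_measure, NNReal.smul_def, smul_eq_mul,
    NNReal.coe_pow, Real.coe_toNNReal _ (inv_pos.2 hr).le, ← mul_assoc, ← mul_pow,
    mul_inv_cancel₀ hr.ne', one_pow, one_mul]

theorem ContinuousOn.integrableOn_of_isCompact {E : Type*} [PseudoMetricSpace E]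
    [MeasurableSpace E] [BorelSpace E] {μ : Measure E} {K : Set E} (hK : IsCompact K)
    (hKm : MeasurableSet K) (hμ : μ K < ⊤) {f : E → ℝ} (hf : ContinuousOn f K) :
    IntegrableOn f K μ := by
  obtain ⟨C, hC⟩ := hK.exists_bound_of_continuousOn hf
  have : IsFiniteMeasure (μ.restrict K) := ⟨by simpa using hμ⟩
  exact Integrable.of_bound (hf.aestronglyMeasurable_of_isCompact hK hKm) C
    ((ae_restrict_iff' hKm).2 (Eventually.of_forall hC))

theorem hasDerivAt_setIntegral_mul_comp {E : Type*} [NormedAddCommGroup E] [NormedSpace ℝ E]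
    [MeasurableSpace E] [BorelSpace E] {μ : Measure E} {K : Set E} (hK : IsCompact K)
    (hKm : MeasurableSet K) (hμ : μ K < ⊤) {U : Set E} (hU : IsOpen U) {f g : E → ℝ}
    (hf : ContDiffOn ℝ 1 f U) (hg : Continuous g) {γ γ' : ℝ → E → E}
    (hγ : Continuous (Function.uncurry γ)) (hγ' : Continuous (Function.uncurry γ'))
    (hd : ∀ t x, HasDerivAt (γ · x) (γ' t x) t) {t₀ : ℝ} (hmem : ∀ x ∈ K, γ t₀ x ∈ U) :
    HasDerivAt (fun t => ∫ x in K, g x * f (γ t x) ∂μ)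
      (∫ x in K, g x * fderiv ℝ f (γ t₀ x) (γ' t₀ x) ∂μ) t₀ := by
  have hev : ∀ᶠ t in 𝓝 t₀, ∀ x ∈ K, γ t x ∈ U :=
    hK.eventually_forall_of_forall_eventually fun x hx =>
      hγ.continuousAt.eventually (hU.mem_nhds (hmem x hx))
  obtain ⟨ε, hε, hball⟩ := Metric.nhds_basis_closedBall.eventually_iff.1 hev
  have hf' : ContinuousOn (fderiv ℝ f) U := hf.continuousOn_fderiv_of_isOpen hU le_rfl
  have hcont : ∀ t ∈ closedBall t₀ ε, ContinuousOn (fun x => g x * f (γ t x)) K := fun t ht =>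
    hg.continuousOn.mul (hf.continuousOn.comp
      (hγ.comp (Continuous.prodMk_right t)).continuousOn (hball ht))
  have hcont' : ContinuousOn
      (fun p : ℝ × E => g p.2 * fderiv ℝ f (γ p.1 p.2) (γ' p.1 p.2)) (closedBall t₀ ε ×ˢ K) := by
    refine (hg.comp continuous_snd).continuousOn.mul (ContinuousOn.clm_apply
      (hf'.comp hγ.continuousOn fun p hp => hball hp.1 p.2 hp.2) hγ'.continuousOn)
  obtain ⟨C, hC⟩ := ((isCompact_closedBall t₀ ε).prod hK).exists_bound_of_continuousOn hcont'
  refine (hasDerivAt_integral_of_dominated_loc_of_deriv_le (s := closedBall t₀ ε)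
    (F' := fun t x => g x * fderiv ℝ f (γ t x) (γ' t x)) (bound := fun _ => C)
    (closedBall_mem_nhds t₀ hε) ?_ ?_ ?_ ?_ ?_ ?_).2
  · filter_upwards [closedBall_mem_nhds t₀ hε] with t ht
    exact (hcont t ht).aestronglyMeasurable_of_isCompact hK hKm
  · exact (hcont t₀ (mem_closedBall_self hε.le)).integrableOn_of_isCompact hK hKm hμ
  · refine ContinuousOn.aestronglyMeasurable_of_isCompact ?_ hK hKm
    exact hcont'.comp (Continuous.prodMk_right t₀).continuousOn
      fun x hx => ⟨mem_closedBall_self hε.le, hx⟩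
  · exact (ae_restrict_iff' hKm).2 (Eventually.of_forall fun x hx t ht => hC (t, x) ⟨ht, hx⟩)
  · exact integrableOn_const hμ.ne
  · refine (ae_restrict_iff' hKm).2 (Eventually.of_forall fun x hx t ht => ?_)
    have hfx := ((hf.contDiffAt (hU.mem_nhds (hball ht x hx))).differentiableAt
      one_ne_zero).hasFDerivAt
    exact (hfx.comp_hasDerivAt t (hd t x)).const_mul _

/-- The rotation by the angle `t` in the plane of the `i`-th and `j`-th coordinates. -/
def planeRotation {n : ℕ} (i j : Fin n) (t : ℝ) (x : Euc n) : Euc n :=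
  x + ((Real.cos t - 1) * x i - Real.sin t * x j) • EuclideanSpace.single i (1 : ℝ)
    + ((Real.cos t - 1) * x j + Real.sin t * x i) • EuclideanSpace.single j (1 : ℝ)

theorem norm_planeRotation {n : ℕ} {i j : Fin n} (hij : i ≠ j) (t : ℝ) (x : Euc n) :
    ‖planeRotation i j t x‖ = ‖x‖ := by
  rw [← sq_eq_sq₀ (norm_nonneg _) (norm_nonneg _), planeRotation, norm_add_sq_real,
    norm_add_sq_real]
  have h1 : (EuclideanSpace.single i (1 : ℝ)) j = 0 := by simp [hij.symm]
  simp only [norm_smul, inner_add_left, inner_smul_left, inner_smul_right,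
    EuclideanSpace.inner_single_right, h1, PiLp.norm_single, mul_pow, Real.norm_eq_abs, sq_abs]
  simp only [conj_trivial]
  linear_combination (x i ^ 2 + x j ^ 2) * Real.sin_sq_add_cos_sq t

theorem setIntegral_sphere_comp_planeRotation {n : ℕ} {i j : Fin n} (hij : i ≠ j) (t : ℝ)
    (f : Euc n → ℝ) :
    ∫ x in sphere (0 : Euc n) 1, f (planeRotation i j t x) ∂(surf n)
      = ∫ x in sphere 0 1, f x ∂(surf n) := by
  let L : Euc n →ₗᵢ[ℝ] Euc n :=
    { toFun := planeRotation i j t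
      map_add' := fun x y => by
        simp only [planeRotation, PiLp.add_apply]; module
      map_smul' := fun c x => by
        simp only [planeRotation, PiLp.smul_apply, smul_eq_mul, RingHom.id_apply]; module
      norm_map' := norm_planeRotation hij t }
  exact setIntegral_sphere_comp_linearIsometryEquiv (L.toLinearIsometryEquiv rfl) f

theorem setIntegral_sphere_fderiv_rotation {n : ℕ} (hn : 1 ≤ n) (i j : Fin n) {U : Set (Euc n)}
    (hU : IsOpen U) (hSU : sphere 0 1 ⊆ U) {f : Euc n → ℝ} (hf : ContDiffOn ℝ 1 f U) :
    ∫ x in sphere (0 : Euc n) 1, fderiv ℝ f x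
      (x i • EuclideanSpace.single j (1 : ℝ) - x j • EuclideanSpace.single i (1 : ℝ)) ∂(surf n)
      = 0 := by
  rcases eq_or_ne i j with rfl | hij
  · simp
  have h0 : ∀ x : Euc n, planeRotation i j 0 x = x := fun x => by simp [planeRotation]
  have h := hasDerivAt_setIntegral_mul_comp (isCompact_sphere (0 : Euc n) 1)
    isClosed_sphere.measurableSet (surf_sphere_lt_top hn) hU hf (continuous_const (y := 1))
    (γ := planeRotation i j)
    (γ' := fun t x =>
      (-Real.sin t * x i - Real.cos t * x j) • EuclideanSpace.single i (1 : ℝ)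
        + (-Real.sin t * x j + Real.cos t * x i) • EuclideanSpace.single j (1 : ℝ)) (t₀ := 0)
    (by unfold planeRotation Function.uncurry; fun_prop) (by unfold Function.uncurry; fun_prop)
    (fun t x => by
      have hc := (Real.hasDerivAt_cos t).sub_const 1
      have hs := Real.hasDerivAt_sin t
      exact ((((hc.mul_const (x i)).sub (hs.mul_const (x j))).smul_const _).const_add x).add
        (((hc.mul_const (x j)).add (hs.mul_const (x i))).smul_const _))
    (fun x hx => by rw [h0]; exact hSU hx)
  simp only [one_mul, setIntegral_sphere_comp_planeRotation hij, h0] at h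
  have h2 := h.unique (hasDerivAt_const 0 _)
  rw [← h2]
  congr 1
  ext x
  congr 1
  simp only [Real.sin_zero, Real.cos_zero]
  module

theorem setIntegral_sphere_div {n : ℕ} (hn : 1 ≤ n) {U : Set (Euc n)} (hU : IsOpen U)
    (hSU : sphere 0 1 ⊆ U) {F : Fin n → Euc n → ℝ} (hF : ∀ i, ContDiffOn ℝ 1 (F i) U) :
    ∫ x in sphere (0 : Euc n) 1, ((∑ j, fderiv ℝ (F j) x (EuclideanSpace.single j 1))
      - (n - 1) * (∑ j, x j * F j x) - ∑ j, x j * fderiv ℝ (F j) x x) ∂(surf n) = 0 := by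
  have hSc := isCompact_sphere (0 : Euc n) 1
  have hSm : MeasurableSet (sphere (0 : Euc n) 1) := isClosed_sphere.measurableSet
  have hco : ∀ i, ContDiff ℝ 1 fun y : Euc n => y i := fun i => by fun_prop
  have hf : ∀ i j, ContDiffOn ℝ 1 (fun y : Euc n => y i * F j y) U := fun i j =>
    (hco i).contDiffOn.mul (hF j)
  have hint : ∀ i j, IntegrableOn (fun x => fderiv ℝ (fun y : Euc n => y i * F j y) x
      (x i • EuclideanSpace.single j (1 : ℝ) - x j • EuclideanSpace.single i (1 : ℝ)))
      (sphere (0 : Euc n) 1) (surf n) := fun i j => by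
    refine ContinuousOn.integrableOn_of_isCompact hSc hSm (surf_sphere_lt_top hn) ?_
    refine ContinuousOn.clm_apply
      (((hf i j).continuousOn_fderiv_of_isOpen hU le_rfl).mono hSU) (by fun_prop)
  have hsum : ∫ x in sphere (0 : Euc n) 1, (∑ i, ∑ j, fderiv ℝ (fun y : Euc n => y i * F j y) x
      (x i • EuclideanSpace.single j (1 : ℝ) - x j • EuclideanSpace.single i (1 : ℝ)))
      ∂(surf n) = 0 := by
    rw [integral_finsetSum _ fun i _ => integrable_finsetSum _ fun j _ => hint i j]
    refine Finset.sum_eq_zero fun i _ => ?_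
    rw [integral_finsetSum _ fun j _ => hint i j]
    exact Finset.sum_eq_zero fun j _ =>
      setIntegral_sphere_fderiv_rotation hn i j hU hSU (hf i j)
  rw [← hsum]
  refine setIntegral_congr_fun hSm fun x hx => ?_
  have hx1 : ∑ i, x i ^ 2 = 1 := by
    rw [← EuclideanSpace.real_norm_sq_eq, mem_sphere_zero_iff_norm.1 hx, one_pow]
  have hxx : ∑ i, x i • EuclideanSpace.single i (1 : ℝ) = x := by
    ext k; simp [Finset.sum_apply, Pi.single_apply]
  have hterm : ∀ i j, fderiv ℝ (fun y : Euc n => y i * F j y) x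
      (x i • EuclideanSpace.single j (1 : ℝ) - x j • EuclideanSpace.single i (1 : ℝ))
      = (if i = j then x i * F j x else 0) - x j * F j x
        + x i ^ 2 * fderiv ℝ (F j) x (EuclideanSpace.single j 1)
        - x j * fderiv ℝ (F j) x (x i • EuclideanSpace.single i 1) := fun i j => by
    have h1 : HasFDerivAt (fun y : Euc n => y i) (EuclideanSpace.proj i : Euc n →L[ℝ] ℝ) x :=
      (EuclideanSpace.proj i : Euc n →L[ℝ] ℝ).hasFDerivAt
    have h2 := (((hF j).contDiffAt (hU.mem_nhds (hSU hx))).differentiableAt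
      one_ne_zero).hasFDerivAt
    rw [(h1.fun_mul h2).fderiv]
    by_cases hij : i = j
    · subst hij; simp; ring
    · simp [hij]; ring
  simp only [hterm, Finset.sum_add_distrib, Finset.sum_sub_distrib]
  simp only [Finset.sum_ite_eq, Finset.mem_univ, if_true, Finset.sum_const, Finset.card_univ,
    Fintype.card_fin, nsmul_eq_mul]
  have e1 : ∑ i, ∑ j, x i ^ 2 * fderiv ℝ (F j) x (EuclideanSpace.single j 1)
      = ∑ j, fderiv ℝ (F j) x (EuclideanSpace.single j 1) := by
    simp_rw [← Finset.mul_sum]; rw [← Finset.sum_mul, hx1, one_mul]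
  have e2 : ∑ i, ∑ j, x j * fderiv ℝ (F j) x (x i • EuclideanSpace.single i 1)
      = ∑ j, x j * fderiv ℝ (F j) x x := by
    rw [Finset.sum_comm]
    refine Finset.sum_congr rfl fun j _ => ?_
    rw [← Finset.mul_sum, ← map_sum, hxx]
  rw [e1, e2]
  ring

/-- A `C¹` divergence-free vector field has zero flux through spheres. -/
theorem setIntegral_sphere_flux_eq_zero {n : ℕ} (hn : 2 ≤ n) {x₀ : Euc n} {R : ℝ}
    {F : Fin n → Euc n → ℝ} (hF : ∀ i, ContDiffOn ℝ 1 (F i) (ball x₀ R))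
    (hdiv : ∀ x ∈ ball x₀ R, ∑ i, fderiv ℝ (F i) x (EuclideanSpace.single i 1) = 0)
    {r : ℝ} (hr : r ∈ Set.Ioo (-R) R) :
    ∫ x in sphere (0 : Euc n) 1, (∑ i, x i * F i (x₀ + r • x)) ∂(surf n) = 0 := by
  have hn1 : 1 ≤ n := by omega
  have hSc := isCompact_sphere (0 : Euc n) 1
  have hSm : MeasurableSet (sphere (0 : Euc n) 1) := isClosed_sphere.measurableSet
  have hmem : ∀ s ∈ Set.Ioo (-R) R, ∀ x ∈ sphere (0 : Euc n) 1, x₀ + s • x ∈ ball x₀ R := by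
    intro s hs x hx
    rw [mem_ball, dist_eq_norm, add_sub_cancel_left, norm_smul, mem_sphere_zero_iff_norm.1 hx,
      mul_one]
    exact abs_lt.2 hs
  have hint : ∀ s ∈ Set.Ioo (-R) R, ∀ i, IntegrableOn (fun x => x i * F i (x₀ + s • x))
      (sphere (0 : Euc n) 1) (surf n) := fun s hs i =>
    ContinuousOn.integrableOn_of_isCompact hSc hSm (surf_sphere_lt_top hn1)
      (ContinuousOn.mul (by fun_prop) ((hF i).continuousOn.comp (by fun_prop) (hmem s hs)))
  have hint' : ∀ s ∈ Set.Ioo (-R) R, ∀ i, IntegrableOn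
      (fun x => x i * fderiv ℝ (F i) (x₀ + s • x) x)
      (sphere (0 : Euc n) 1) (surf n) := fun s hs i =>
    ContinuousOn.integrableOn_of_isCompact hSc hSm (surf_sphere_lt_top hn1)
      (ContinuousOn.mul (by fun_prop) (ContinuousOn.clm_apply
        (((hF i).continuousOn_fderiv_of_isOpen isOpen_ball le_rfl).comp
          (by fun_prop) (hmem s hs)) continuousOn_id))
  let ψ : ℝ → ℝ := fun s => ∑ i, ∫ x in sphere (0 : Euc n) 1, x i * F i (x₀ + s • x) ∂(surf n)
  let ψ' : ℝ → ℝ := fun s =>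
    ∑ i, ∫ x in sphere (0 : Euc n) 1, x i * fderiv ℝ (F i) (x₀ + s • x) x ∂(surf n)
  have hψ : ∀ s ∈ Set.Ioo (-R) R, HasDerivAt ψ (ψ' s) s := fun s hs =>
    HasDerivAt.fun_sum fun i _ => hasDerivAt_setIntegral_mul_comp (γ := fun t x => x₀ + t • x)
      (γ' := fun t x => x) (g := fun x => x i) hSc hSm
      (surf_sphere_lt_top hn1) isOpen_ball (hF i) (by fun_prop)
      (by unfold Function.uncurry; fun_prop) (by unfold Function.uncurry; fun_prop)
      (fun t x => by simpa using ((hasDerivAt_id t).smul_const x).const_add x₀) (hmem s hs)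
  have hode : ∀ s ∈ Set.Ioo (-R) R, (n - 1) * ψ s + s * ψ' s = 0 := by
    intro s hs
    have hcd : ContDiff ℝ 1 fun x : Euc n => x₀ + s • x := by fun_prop
    have hfd : ∀ i, ∀ x ∈ sphere (0 : Euc n) 1, ∀ v,
        fderiv ℝ (fun y => F i (x₀ + s • y)) x v = s * fderiv ℝ (F i) (x₀ + s • x) v := by
      intro i x hx v
      have h1 := (((hF i).contDiffAt (isOpen_ball.mem_nhds (hmem s hs x hx))).differentiableAt
        one_ne_zero).hasFDerivAt
      have h2 : HasFDerivAt (fun y : Euc n => x₀ + s • y) (s • ContinuousLinearMap.id ℝ (Euc n)) x :=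
        ((hasFDerivAt_id x).const_smul s).const_add x₀
      have h3 := (h1.comp x h2).fderiv
      change fderiv ℝ (F i ∘ fun y => x₀ + s • y) x v = _
      rw [h3]
      simp
    have h := setIntegral_sphere_div hn1 (U := (fun x => x₀ + s • x) ⁻¹' ball x₀ R)
      (isOpen_ball.preimage hcd.continuous) (hmem s hs) (F := fun i x => F i (x₀ + s • x))
      (fun i => (hF i).comp hcd.contDiffOn fun x hx => hx)
    have h' : ∫ x in sphere (0 : Euc n) 1, (-((n - 1) * (∑ j, x j * F j (x₀ + s • x))
        + s * ∑ j, x j * fderiv ℝ (F j) (x₀ + s • x) x)) ∂(surf n) = 0 := by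
      rw [← h]
      refine setIntegral_congr_fun hSm fun x hx => ?_
      simp only [hfd _ x hx, ← Finset.mul_sum, hdiv _ (hmem s hs x hx), mul_left_comm _ s]
      ring
    rw [integral_neg, neg_eq_zero, integral_add, integral_const_mul, integral_const_mul,
      integral_finsetSum _ fun i _ => hint s hs i,
      integral_finsetSum _ fun i _ => hint' s hs i] at h'
    · exact h'
    · exact (integrable_finsetSum _ fun i _ => hint s hs i).const_mul _
    · exact (integrable_finsetSum _ fun i _ => hint' s hs i).const_mul _
  obtain ⟨m, rfl⟩ := Nat.exists_eq_add_of_le' hn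
  have hder : ∀ s ∈ Set.Ioo (-R) R, HasDerivAt (fun s => s ^ (m + 1) * ψ s) 0 s := by
    intro s hs
    refine ((hasDerivAt_pow (m + 1) s).mul (hψ s hs)).congr_deriv ?_
    have := hode s hs
    push_cast at this ⊢
    rw [pow_succ]
    linear_combination s ^ m * this
  rw [integral_finsetSum _ fun i _ => hint r hr i]
  change ψ r = 0
  have h0 : (0 : ℝ) ∈ Set.Ioo (-R) R := ⟨by linarith [hr.1, hr.2], by linarith [hr.1, hr.2]⟩
  rcases eq_or_ne r 0 with rfl | hr0
  · have := hode 0 h0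
    push_cast at this
    rw [zero_mul, add_zero, mul_eq_zero] at this
    exact this.resolve_left (by linarith [m.cast_nonneg (α := ℝ)])
  · have hconst := isOpen_Ioo.is_const_of_deriv_eq_zero isPreconnected_Ioo
      (fun s hs => (hder s hs).differentiableAt.differentiableWithinAt)
      (fun s hs => (hder s hs).deriv) hr h0
    simpa [hr0] using hconst

theorem sum_apply_smul_single {n : ℕ} (L : Euc n →L[ℝ] ℝ) (x : Euc n) :
    ∑ i, x i * L (EuclideanSpace.single i 1) = L x := by
  have hx : ∑ i, x i • EuclideanSpace.single i (1 : ℝ) = x := by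
    ext k; simp [Finset.sum_apply, Pi.single_apply]
  conv_rhs => rw [← hx, map_sum]
  simp

theorem ContDiffOn.fderiv_apply_const {n : ℕ} {U : Set (Euc n)} {H : Euc n → ℝ}
    (hH : ContDiffOn ℝ 2 H U) (hU : IsOpen U) (v : Euc n) :
    ContDiffOn ℝ 1 (fun x => fderiv ℝ H x v) U :=
  (hH.fderiv_of_isOpen hU (by norm_num)).clm_apply contDiffOn_const

/-- The mean value property of harmonic functions. -/
theorem setIntegral_sphere_of_lap_eq_zero {n : ℕ} (hn : 2 ≤ n) {x₀ : Euc n} {R : ℝ}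
    {H : Euc n → ℝ} (hH : ContDiffOn ℝ 2 H (ball x₀ R)) (hlap : ∀ x ∈ ball x₀ R, lap n H x = 0)
    {r : ℝ} (hr : r ∈ Set.Ioo (-R) R) :
    ∫ x in sphere (0 : Euc n) 1, H (x₀ + r • x) ∂(surf n) = omegaSph n * H x₀ := by
  have hder : ∀ s ∈ Set.Ioo (-R) R, HasDerivAt
      (fun s => ∫ x in sphere (0 : Euc n) 1, H (x₀ + s • x) ∂(surf n)) 0 s := by
    intro s hs
    have h := hasDerivAt_setIntegral_mul_comp (γ := fun t x => x₀ + t • x)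
      (γ' := fun t x => x) (isCompact_sphere (0 : Euc n) 1) isClosed_sphere.measurableSet
      (surf_sphere_lt_top (by omega)) isOpen_ball (hH.of_le (by norm_num))
      (continuous_const (y := 1))
      (by unfold Function.uncurry; fun_prop) (by unfold Function.uncurry; fun_prop)
      (fun t x => by simpa using ((hasDerivAt_id t).smul_const x).const_add x₀) (t₀ := s)
      (fun x hx => by
        rw [mem_ball, dist_eq_norm, add_sub_cancel_left, norm_smul,
          mem_sphere_zero_iff_norm.1 hx, mul_one]
        exact abs_lt.2 hs)
    have hflux := setIntegral_sphere_flux_eq_zero hn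
      (fun i => hH.fderiv_apply_const isOpen_ball (EuclideanSpace.single i 1)) hlap hs
    simp only [sum_apply_smul_single] at hflux
    simpa only [one_mul, hflux] using h
  have hconst := isOpen_Ioo.is_const_of_deriv_eq_zero isPreconnected_Ioo
    (fun s hs => (hder s hs).differentiableAt.differentiableWithinAt)
    (fun s hs => (hder s hs).deriv) hr
    (⟨by linarith [hr.1, hr.2], by linarith [hr.1, hr.2]⟩ : (0 : ℝ) ∈ Set.Ioo (-R) R)
  simpa [omegaSph, Measure.real] using hconst

theorem setIntegral_sphere_fderiv_of_lap_eq_zero {n : ℕ} (hn : 2 ≤ n) {x₀ : Euc n} {R : ℝ}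
    {H : Euc n → ℝ} (hH : ContDiffOn ℝ 2 H (ball x₀ R)) (hlap : ∀ x ∈ ball x₀ R, lap n H x = 0)
    {r : ℝ} (hr : 0 < r) (hrR : r < R) (v : Euc n) :
    ∫ x in sphere (0 : Euc n) 1, fderiv ℝ H (x₀ + r • x) v ∂(surf n)
      = omegaSph n * fderiv ℝ H x₀ v := by
  have h := hasDerivAt_setIntegral_mul_comp (γ := fun t x => x₀ + t • v + r • x)
    (γ' := fun t x => v) (isCompact_sphere (0 : Euc n) 1) isClosed_sphere.measurableSet
    (surf_sphere_lt_top (by omega)) isOpen_ball (hH.of_le (by norm_num))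
    (continuous_const (y := 1))
    (by unfold Function.uncurry; fun_prop) (by unfold Function.uncurry; fun_prop)
    (fun t x => by
      simpa using (((hasDerivAt_id t).smul_const v).const_add x₀).add_const (r • x)) (t₀ := 0)
    (fun x hx => by
      rw [mem_ball, dist_eq_norm, zero_smul, add_zero, add_sub_cancel_left, norm_smul,
        mem_sphere_zero_iff_norm.1 hx, mul_one]
      exact abs_lt.2 ⟨by linarith, hrR⟩)
  simp only [one_mul, zero_smul, add_zero] at h
  have hline : HasDerivAt (fun t : ℝ => x₀ + t • v) v 0 := by
    simpa using ((hasDerivAt_id (0 : ℝ)).smul_const v).const_add x₀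
  have hx₀ : x₀ ∈ ball x₀ R := mem_ball_self (by linarith)
  have hHx : HasFDerivAt H (fderiv ℝ H x₀) (x₀ + (0 : ℝ) • v) := by
    rw [zero_smul, add_zero]
    exact ((hH.contDiffAt (isOpen_ball.mem_nhds hx₀)).differentiableAt two_ne_zero).hasFDerivAt
  have h' := (hHx.comp_hasDerivAt 0 hline).const_mul (omegaSph n)
  refine h.unique (h'.congr_of_eventuallyEq ?_)
  have hev : ∀ᶠ t : ℝ in 𝓝 0, x₀ + t • v ∈ ball x₀ (R - r) := by
    refine hline.continuousAt.eventually (isOpen_ball.mem_nhds ?_)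
    simpa using hrR
  filter_upwards [hev] with t ht
  have hsub : ball (x₀ + t • v) (R - dist (x₀ + t • v) x₀) ⊆ ball x₀ R :=
    ball_subset_ball' (by simp)
  rw [mem_ball] at ht
  exact setIntegral_sphere_of_lap_eq_zero hn (hH.mono hsub) (fun x hx => hlap x (hsub hx))
    ⟨by linarith, by linarith⟩

/-- The Pohozaev vector field `2 ∂ⱼH ∇H - |∇H|² eⱼ` of a harmonic function has zero flux
through spheres. -/
theorem setIntegral_sphere_pohozaev_of_lap_eq_zero {n : ℕ} (hn : 2 ≤ n) {x₀ : Euc n} {R : ℝ}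
    {H : Euc n → ℝ} (hH : ContDiffOn ℝ 2 H (ball x₀ R)) (hlap : ∀ x ∈ ball x₀ R, lap n H x = 0)
    {r : ℝ} (hr : r ∈ Set.Ioo (-R) R) (j : Fin n) :
    ∫ x in sphere (0 : Euc n) 1, (2 * fderiv ℝ H (x₀ + r • x) (EuclideanSpace.single j 1)
      * fderiv ℝ H (x₀ + r • x) x
      - x j * ∑ k, fderiv ℝ H (x₀ + r • x) (EuclideanSpace.single k 1) ^ 2) ∂(surf n) = 0 := by
  let D : Fin n → Euc n → ℝ := fun i x => fderiv ℝ H x (EuclideanSpace.single i 1)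
  have hD : ∀ i, ContDiffOn ℝ 1 (D i) (ball x₀ R) := fun i =>
    hH.fderiv_apply_const isOpen_ball _
  let F : Fin n → Euc n → ℝ := fun i x =>
    2 * D j x * D i x - (if i = j then 1 else 0) * ∑ k, D k x ^ 2
  have hF : ∀ i, ContDiffOn ℝ 1 (F i) (ball x₀ R) := fun i =>
    ((contDiffOn_const.mul (hD j)).mul (hD i)).sub
      (contDiffOn_const.mul (ContDiffOn.sum fun k _ => (hD k).pow 2))
  have hdiv : ∀ x ∈ ball x₀ R, ∑ i, fderiv ℝ (F i) x (EuclideanSpace.single i 1) = 0 := by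
    intro x hx
    have hnx := isOpen_ball.mem_nhds hx
    have hd : ∀ i, HasFDerivAt (D i) (fderiv ℝ (D i) x) x := fun i =>
      (((hD i).contDiffAt hnx).differentiableAt one_ne_zero).hasFDerivAt
    have hsymm : ∀ i, fderiv ℝ (D j) x (EuclideanSpace.single i 1)
        = fderiv ℝ (D i) x (EuclideanSpace.single j 1) := by
      have hfd : DifferentiableAt ℝ (fderiv ℝ H) x :=
        (((hH.fderiv_of_isOpen isOpen_ball (by norm_num : (1 : WithTop ℕ∞) + 1 ≤ 2)).contDiffAt
          hnx).differentiableAt one_ne_zero)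
      have hDi : ∀ i v, fderiv ℝ (D i) x v
          = fderiv ℝ (fderiv ℝ H) x v (EuclideanSpace.single i 1) := fun i v => by
        have := (hfd.hasFDerivAt.clm_apply
          (hasFDerivAt_const (EuclideanSpace.single i (1 : ℝ)) x)).fderiv
        change fderiv ℝ (fun y => fderiv ℝ H y (EuclideanSpace.single i 1)) x v = _
        rw [this]; simp
      intro i
      rw [hDi, hDi]
      exact (hH.contDiffAt hnx).isSymmSndFDerivAt (by simp) _ _
    have hlapx : ∑ i, fderiv ℝ (D i) x (EuclideanSpace.single i 1) = 0 := hlap x hx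
    have hFi : ∀ i, fderiv ℝ (F i) x (EuclideanSpace.single i 1)
        = 2 * D j x * fderiv ℝ (D i) x (EuclideanSpace.single i 1)
          + 2 * (D i x * fderiv ℝ (D i) x (EuclideanSpace.single j 1))
          - if i = j then ∑ k, 2 * (D k x * fderiv ℝ (D k) x (EuclideanSpace.single j 1))
            else 0 := by
      intro i
      have h := ((((hd j).const_mul 2).fun_mul (hd i)).fun_sub
        ((HasFDerivAt.fun_sum fun k (_ : k ∈ Finset.univ) => (hd k).pow 2).const_mul
          (if i = j then 1 else 0))).fderiv
      rw [h]
      by_cases hij : i = j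
      · subst hij
        simp [mul_assoc]
        ring
      · simp [hij, hsymm]
        ring
    simp only [hFi, Finset.sum_sub_distrib, Finset.sum_add_distrib, ← Finset.mul_sum, hlapx]
    simp
  rw [← setIntegral_sphere_flux_eq_zero hn hF hdiv hr]
  refine setIntegral_congr_fun isClosed_sphere.measurableSet fun x _ => ?_
  simp only [F, mul_sub, Finset.sum_sub_distrib, ← sum_apply_smul_single (fderiv ℝ H (x₀ + r • x)) x]
  congr 1
  · rw [Finset.mul_sum]
    exact Finset.sum_congr rfl fun i _ => by simp only [D]; ring
  · simp [D]

theorem norm_gradient_sq {n : ℕ} (f : Euc n → ℝ) (x : Euc n) :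
    ‖gradient f x‖ ^ 2 = ∑ i, fderiv ℝ f x (EuclideanSpace.single i 1) ^ 2 := by
  rw [EuclideanSpace.real_norm_sq_eq]
  refine Finset.sum_congr rfl fun i _ => ?_
  have h : inner ℝ (gradient f x) (EuclideanSpace.single i (1 : ℝ))
      = fderiv ℝ f x (EuclideanSpace.single i 1) := by
    rw [gradient, InnerProductSpace.toDual_symm_apply]
  rw [← h, EuclideanSpace.inner_single_right]
  simp

theorem hasFDerivAt_norm_sub_rpow {n : ℕ} (x₀ : Euc n) (p : ℝ) {r : ℝ} (hr : 0 < r) {ω : Euc n}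
    (hω : ‖ω‖ = 1) :
    HasFDerivAt (fun y => ‖y - x₀‖ ^ p) ((p * r ^ (p - 1)) • innerSL ℝ ω) (x₀ + r • ω) := by
  have hx : ‖x₀ + r • ω - x₀‖ ^ 2 = r ^ 2 := by
    rw [add_sub_cancel_left, norm_smul, hω, Real.norm_eq_abs, mul_one, sq_abs]
  have h1 := ((hasFDerivAt_id (x₀ + r • ω)).sub_const x₀).norm_sq
  have h2 := h1.rpow_const (p := p / 2) (Or.inl (by rw [id, hx]; positivity))
  have hfun : (fun y : Euc n => ‖y - x₀‖ ^ p) = fun y => (‖id y - x₀‖ ^ 2) ^ (p / 2) := by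
    ext y
    rw [id, ← Real.rpow_natCast, ← Real.rpow_mul (norm_nonneg _)]
    congr 1; push_cast; ring
  rw [hfun]
  refine h2.congr_fderiv ?_
  have hpow : (r ^ 2) ^ (p / 2 - 1) * r = r ^ (p - 1) := by
    rw [← Real.rpow_natCast r 2, ← Real.rpow_mul hr.le]
    nth_rw 2 [← Real.rpow_one r]
    rw [← Real.rpow_add hr]
    congr 1; push_cast; ring
  ext v
  simp only [id, hx]
  simp [← hpow]
  ring

/-- The Pohozaev-type boundary integral of `G = c_n|x-x₀|^{2-n} - H`, with `H` harmonic,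
is independent of the radius and equals `2(n-2) c_n ω_{n-1} ∂_j H(x₀)`. -/
theorem sphere_integral_of_green_function
    (n : ℕ) (hn : 3 ≤ n)
    (x₀ : Euc n) (R : ℝ) (hR : 0 < R)
    (H : Euc n → ℝ)
    (hH2 : ContDiffOn ℝ 2 H (ball x₀ R))
    (hHharm : ∀ x ∈ ball x₀ R, lap n H x = 0)
    (G : Euc n → ℝ)
    (hG : ∀ x, x ≠ x₀ → G x = cGreen n * ‖x - x₀‖ ^ ((2 : ℝ) - n) - H x)
    (r : ℝ) (hr : 0 < r) (hrR : r < R) (j : Fin n) :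
    ∫ x in sphere x₀ r,
        (2 * fderiv ℝ G x (r⁻¹ • (x - x₀)) * fderiv ℝ G x (EuclideanSpace.single j 1)
          - ‖gradient G x‖ ^ 2 * ((x j - x₀ j) / r)) ∂(surf n)
      = 2 * ((n : ℝ) - 2) * cGreen n * omegaSph n
          * fderiv ℝ H x₀ (EuclideanSpace.single j 1) := by
  have hn1 : 1 ≤ n := by omega
  have hn2 : 2 ≤ n := by omega
  have hrI : r ∈ Set.Ioo (-R) R := ⟨by linarith, hrR⟩
  have hSc := isCompact_sphere (0 : Euc n) 1
  have hSm : MeasurableSet (sphere (0 : Euc n) 1) := isClosed_sphere.measurableSet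
  have hmem : ∀ x ∈ sphere (0 : Euc n) 1, x₀ + r • x ∈ ball x₀ R := by
    intro x hx
    rw [mem_ball, dist_eq_norm, add_sub_cancel_left, norm_smul, mem_sphere_zero_iff_norm.1 hx,
      mul_one]
    exact abs_lt.2 hrI
  set a : ℝ := cGreen n * ((2 - n) * r ^ ((2 : ℝ) - n - 1)) with ha
  have hGd : ∀ x ∈ sphere (0 : Euc n) 1, ∀ v, fderiv ℝ G (x₀ + r • x) v
      = a * inner ℝ x v - fderiv ℝ H (x₀ + r • x) v := by
    intro x hx v
    have hx1 : ‖x‖ = 1 := mem_sphere_zero_iff_norm.1 hx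
    have hne : x₀ + r • x ≠ x₀ := by
      have hx0 : x ≠ 0 := by rintro rfl; simp at hx1
      simp [hr.ne', hx0]
    have h1 := (hasFDerivAt_norm_sub_rpow x₀ ((2 : ℝ) - n) hr hx1).const_mul (cGreen n)
    have h2 := ((hH2.contDiffAt (isOpen_ball.mem_nhds (hmem x hx))).differentiableAt
      two_ne_zero).hasFDerivAt
    have hGe : G =ᶠ[𝓝 (x₀ + r • x)] fun y => cGreen n * ‖y - x₀‖ ^ ((2 : ℝ) - n) - H y := by
      filter_upwards [isOpen_ne.mem_nhds hne] with y hy using hG y hy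
    rw [((h1.fun_sub h2).congr_of_eventuallyEq hGe).fderiv]
    simp [ha, mul_assoc]
  let P : Euc n → ℝ := fun x => 2 * fderiv ℝ H (x₀ + r • x) (EuclideanSpace.single j 1)
      * fderiv ℝ H (x₀ + r • x) x
      - x j * ∑ k, fderiv ℝ H (x₀ + r • x) (EuclideanSpace.single k 1) ^ 2
  have hpt : ∀ x ∈ sphere (0 : Euc n) 1,
      2 * fderiv ℝ G (x₀ + r • x) (r⁻¹ • (x₀ + r • x - x₀))
          * fderiv ℝ G (x₀ + r • x) (EuclideanSpace.single j 1)
        - ‖gradient G (x₀ + r • x)‖ ^ 2 * (((x₀ + r • x) j - x₀ j) / r)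
      = a ^ 2 * x j - 2 * a * fderiv ℝ H (x₀ + r • x) (EuclideanSpace.single j 1) + P x := by
    intro x hx
    have hx1 : ‖x‖ = 1 := mem_sphere_zero_iff_norm.1 hx
    have hsq : ∑ i, x i ^ 2 = 1 := by
      rw [← EuclideanSpace.real_norm_sq_eq, hx1, one_pow]
    have hν : r⁻¹ • (x₀ + r • x - x₀) = x := by
      rw [add_sub_cancel_left, inv_smul_smul₀ hr.ne']
    have hνj : ((x₀ + r • x) j - x₀ j) / r = x j := by
      simp [hr.ne']
    have hgrad : ‖gradient G (x₀ + r • x)‖ ^ 2 = a ^ 2 - 2 * a * fderiv ℝ H (x₀ + r • x) x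
        + ∑ k, fderiv ℝ H (x₀ + r • x) (EuclideanSpace.single k 1) ^ 2 := by
      have hterm : ∀ k, fderiv ℝ G (x₀ + r • x) (EuclideanSpace.single k 1) ^ 2
          = a ^ 2 * x k ^ 2
            - 2 * a * (x k * fderiv ℝ H (x₀ + r • x) (EuclideanSpace.single k 1))
            + fderiv ℝ H (x₀ + r • x) (EuclideanSpace.single k 1) ^ 2 := fun k => by
        rw [hGd x hx, EuclideanSpace.inner_single_right, conj_trivial]
        ring
      simp only [norm_gradient_sq, hterm, Finset.sum_add_distrib, Finset.sum_sub_distrib,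
        ← Finset.mul_sum, hsq, sum_apply_smul_single, mul_one]
    rw [hν, hνj, hgrad, hGd x hx, hGd x hx, real_inner_self_eq_norm_sq, hx1,
      EuclideanSpace.inner_single_right, conj_trivial]
    simp only [P]
    ring
  have hHc : ContinuousOn (fun x => fderiv ℝ H (x₀ + r • x)) (sphere (0 : Euc n) 1) :=
    (hH2.continuousOn_fderiv_of_isOpen isOpen_ball (by norm_num)).comp (by fun_prop) hmem
  have hHv : ∀ v, ContinuousOn (fun x => fderiv ℝ H (x₀ + r • x) v) (sphere (0 : Euc n) 1) :=
    fun v => hHc.clm_apply continuousOn_const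
  have hi1 : IntegrableOn (fun x : Euc n => a ^ 2 * x j) (sphere (0 : Euc n) 1) (surf n) :=
    ContinuousOn.integrableOn_of_isCompact hSc hSm (surf_sphere_lt_top hn1) (by fun_prop)
  have hi2 : IntegrableOn
      (fun x => 2 * a * fderiv ℝ H (x₀ + r • x) (EuclideanSpace.single j 1))
      (sphere (0 : Euc n) 1) (surf n) :=
    ContinuousOn.integrableOn_of_isCompact hSc hSm (surf_sphere_lt_top hn1)
      (continuousOn_const.mul (hHv _))
  have hi12 : IntegrableOn (fun x => a ^ 2 * x j
      - 2 * a * fderiv ℝ H (x₀ + r • x) (EuclideanSpace.single j 1))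
      (sphere (0 : Euc n) 1) (surf n) := hi1.sub hi2
  have hi3 : IntegrableOn P (sphere (0 : Euc n) 1) (surf n) :=
    ContinuousOn.integrableOn_of_isCompact hSc hSm (surf_sphere_lt_top hn1)
      (((continuousOn_const.mul (hHv _)).mul (hHc.clm_apply continuousOn_id)).sub
        (ContinuousOn.mul (by fun_prop) (continuousOn_finsetSum _ fun k _ => (hHv _).pow 2)))
  have hcoord : ∫ x in sphere (0 : Euc n) 1, x j ∂(surf n) = 0 := by
    simpa using setIntegral_sphere_flux_eq_zero hn2 (x₀ := x₀) (R := R)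
      (F := fun i _ => if i = j then 1 else 0) (fun i => contDiffOn_const) (by simp) hrI
  have hP : ∫ x in sphere (0 : Euc n) 1, P x ∂(surf n) = 0 :=
    setIntegral_sphere_pohozaev_of_lap_eq_zero hn2 hH2 hHharm hrI j
  rw [setIntegral_sphere_eq_smul hn1 x₀ hr, setIntegral_congr_fun hSm hpt,
    integral_add hi12 hi3, integral_sub hi1 hi2, integral_const_mul, integral_const_mul,
    hcoord, setIntegral_sphere_fderiv_of_lap_eq_zero hn2 hH2 hHharm hr hrR, hP]
  have hpow : r ^ (n - 1) * r ^ ((2 : ℝ) - n - 1) = 1 := by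
    rw [← Real.rpow_natCast, ← Real.rpow_add hr, Nat.cast_sub hn1,
      show ((n : ℝ) - (1 : ℕ) + (2 - n - 1)) = 0 by push_cast; ring, Real.rpow_zero]
  rw [ha]
  linear_combination (2 * ((n : ℝ) - 2) * cGreen n * omegaSph n
          * fderiv ℝ H x₀ (EuclideanSpace.single j 1)) * hpow
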